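/- Let L, L_r, L_s, Σ, Q be a normed continuous-time Markov game structure and fix t ∈ ℝ, ε > 0. If f : L → ℝ → ℝ solves the Bellman equations on [t−ε, t] with terminal value x : L → ℝ and x(l) ∈ [0,1] for every l ∈ L, then f(l, τ) ∈ [0,1] for every l ∈ L and every τ ∈ [t−ε, t]. -/

import Mathlib

/-- A normed continuous-time Markov game structure: a finite nonempty set `L` of
locations partitioned into reachability locations (`isReach l = true`) and safety
locations (`isReach l = false`), a finite set `A` of actions with a nonempty set
`enabled l` of enabled actions at each location, and a rate matrix `R` whose rows
(for enabled actions) are probability distributions on `L`. -/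
structure NCTMG (L A : Type) [Fintype L] [DecidableEq L] [Fintype A] where
  isReach : L → Bool
  enabled : L → Finset A
  enabled_nonempty : ∀ l, (enabled l).Nonempty
  R : L → A → L → ℝ
  R_nonneg : ∀ l a l', a ∈ enabled l → 0 ≤ R l a l'
  R_sum : ∀ l a, a ∈ enabled l → (∑ l', R l a l') = 1

namespace NCTMG

variable {L A : Type} [Fintype L] [DecidableEq L] [Fintype A]

/-- The generator `Q(l,a,l') = R(l,a,l') − δ_{l,l'}`. -/
def Q (M : NCTMG L A) (l : L) (a : A) (l' : L) : ℝ :=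
  M.R l a l' - (if l = l' then 1 else 0)

/-- `opt_l`: maximum over enabled actions at reachability locations, minimum
over enabled actions at safety locations. -/
noncomputable def opt (M : NCTMG L A) (l : L) (v : A → ℝ) : ℝ :=
  if M.isReach l then (M.enabled l).sup' (M.enabled_nonempty l) v
  else (M.enabled l).inf' (M.enabled_nonempty l) v

/-- `f` solves the Bellman equations on `[t−ε, t]` with terminal value `x`. -/
def SolvesBellman (M : NCTMG L A) (t ε : ℝ) (x : L → ℝ) (f : L → ℝ → ℝ) : Prop :=
  (∀ l, f l t = x l) ∧
  ∀ l, ∀ τ ∈ Set.Icc (t - ε) t,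
    HasDerivAt (f l) (-(M.opt l (fun a => ∑ l', M.Q l a l' * f l' τ))) τ

/-- `p1` is a single `ε`-net approximation from terminal value `x` with chosen
actions `act`: each `act l` is enabled and attains `opt_l` of `∑ Q(l,a,·)·x`,
and `p1(l, t−τ) = x(l) + τ·c_l` on `[0,ε]` where `c_l = ∑ Q(l,act l,·)·x`. -/
def IsSingleNet (M : NCTMG L A) (t ε : ℝ) (x : L → ℝ) (act : L → A)
    (p1 : L → ℝ → ℝ) : Prop :=
  (∀ l, act l ∈ M.enabled l) ∧
  (∀ l, (∑ l', M.Q l (act l) l' * x l') =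
      M.opt l (fun a => ∑ l', M.Q l a l' * x l')) ∧
  (∀ l, ∀ τ ∈ Set.Icc (0 : ℝ) ε,
      p1 l (t - τ) = x l + τ * (∑ l', M.Q l (act l) l' * x l'))

end NCTMG

/-- The sup-norm `‖v‖ = max_{l∈L} |v l|` on functions `L → ℝ`. -/
noncomputable def supNorm {L : Type} [Fintype L] [Nonempty L] (v : L → ℝ) : ℝ :=
  Finset.univ.sup' Finset.univ_nonempty (fun l => |v l|)


/-- Maximum principle for finitely many functions run backwards in time: if every function
attaining the pointwise maximum has nonnegative derivative, a bound at the right endpoint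
holds on the whole interval. -/
theorem le_of_hasDerivAt_nonneg_of_forall_le {L : Type*} [Finite L] {a b c : ℝ}
    {f f' : L → ℝ → ℝ} (hb : ∀ l, f l b ≤ c)
    (hf : ∀ l, ∀ τ ∈ Set.Icc a b, HasDerivAt (f l) (f' l τ) τ)
    (hmax : ∀ l, ∀ τ ∈ Set.Icc a b, (∀ l', f l' τ ≤ f l τ) → 0 ≤ f' l τ) :
    ∀ l, ∀ τ ∈ Set.Icc a b, f l τ ≤ c := by
  intro l₀ τ₀ hτ₀
  have hab : a ≤ b := hτ₀.1.trans hτ₀.2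
  have key : ∀ δ : ℝ, 0 < δ → f l₀ τ₀ ≤ c + δ * (b - τ₀) := by
    intro δ hδ
    have hmaxOn : ∀ l, ∃ τ ∈ Set.Icc a b, IsMaxOn (fun s => f l s + δ * s) (Set.Icc a b) τ := by
      intro l
      refine isCompact_Icc.exists_isMaxOn ⟨a, le_rfl, hab⟩ fun τ hτ => ?_
      exact ((hf l τ hτ).continuousAt.add (by fun_prop)).continuousWithinAt
    choose σ hσ hσmax using hmaxOn
    have : Nonempty L := ⟨l₀⟩
    obtain ⟨m, hm⟩ := Finite.exists_max fun l => f l (σ l) + δ * σ l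
    have hall : ∀ l, ∀ s ∈ Set.Icc a b, f l s + δ * s ≤ f m (σ m) + δ * σ m :=
      fun l s hs => (hσmax l hs).trans (hm l)
    have hσb : σ m = b := by
      by_contra hne
      have hlt : σ m < b := lt_of_le_of_ne (hσ m).2 hne
      have hpos : 0 ≤ f' m (σ m) :=
        hmax m _ (hσ m) fun l' => by linarith [hall l' _ (hσ m)]
      have hd : HasDerivAt (fun s => f m s + δ * s) (f' m (σ m) + δ) (σ m) := by
        simpa using (hf m _ (hσ m)).fun_add ((hasDerivAt_id (σ m)).const_mul δ)
      have hslope := hd.hasDerivWithinAt (s := Set.Ioi (σ m))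
      rw [hasDerivWithinAt_iff_tendsto_slope' (by simp)] at hslope
      have hev := hslope.eventually (lt_mem_nhds (show 0 < f' m (σ m) + δ by linarith))
      obtain ⟨s, hs, hsI⟩ := (hev.and (Ioo_mem_nhdsGT hlt)).exists
      rw [slope_def_field] at hs
      have hle := hall m s ⟨(hσ m).1.trans hsI.1.le, hsI.2.le⟩
      exact absurd hs (not_lt.2 (div_nonpos_of_nonpos_of_nonneg (by linarith)
        (by linarith [hsI.1])))
    have h := hall l₀ τ₀ hτ₀
    rw [hσb] at h
    linarith [hb m]
  by_contra! hlt
  have hden : 0 < b - τ₀ + 1 := by linarith [hτ₀.2]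
  have hδ : 0 < (f l₀ τ₀ - c) / (b - τ₀ + 1) := div_pos (by linarith) hden
  have h := key _ hδ
  have heq : (f l₀ τ₀ - c) / (b - τ₀ + 1) * (b - τ₀ + 1) = f l₀ τ₀ - c :=
    div_mul_cancel₀ _ hden.ne'
  linarith

namespace NCTMG

variable {L A : Type} [Fintype L] [DecidableEq L] [Fintype A]

theorem sum_Q_mul (M : NCTMG L A) {l : L} {a : A} (ha : a ∈ M.enabled l) (v : L → ℝ) :
    ∑ l', M.Q l a l' * v l' = ∑ l', M.R l a l' * (v l' - v l) := by
  simp [Q, sub_mul, mul_sub, Finset.sum_sub_distrib, ← Finset.sum_mul, M.R_sum l a ha]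

theorem exists_mem_enabled_opt_eq (M : NCTMG L A) (l : L) (v : A → ℝ) :
    ∃ a ∈ M.enabled l, M.opt l v = v a := by
  unfold opt
  split_ifs
  · exact Finset.exists_mem_eq_sup' _ v
  · exact Finset.exists_mem_eq_inf' _ v

theorem opt_sum_Q_nonpos (M : NCTMG L A) {l : L} {v : L → ℝ} (hv : ∀ l', v l' ≤ v l) :
    M.opt l (fun a => ∑ l', M.Q l a l' * v l') ≤ 0 := by
  obtain ⟨a, ha, h⟩ := M.exists_mem_enabled_opt_eq l fun a => ∑ l', M.Q l a l' * v l'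
  rw [h, M.sum_Q_mul ha]
  exact Finset.sum_nonpos fun l' _ =>
    mul_nonpos_of_nonneg_of_nonpos (M.R_nonneg l a l' ha) (sub_nonpos.2 (hv l'))

theorem opt_sum_Q_nonneg (M : NCTMG L A) {l : L} {v : L → ℝ} (hv : ∀ l', v l ≤ v l') :
    0 ≤ M.opt l (fun a => ∑ l', M.Q l a l' * v l') := by
  obtain ⟨a, ha, h⟩ := M.exists_mem_enabled_opt_eq l fun a => ∑ l', M.Q l a l' * v l'
  rw [h, M.sum_Q_mul ha]
  exact Finset.sum_nonneg fun l' _ => mul_nonneg (M.R_nonneg l a l' ha) (sub_nonneg.2 (hv l'))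

end NCTMG

/-- a Bellman solution with terminal value in `[0,1]` takes values
in `[0,1]` throughout `[t−ε, t]`. -/
theorem bellman_mem_unitInterval {L A : Type} [Fintype L] [DecidableEq L]
    [Nonempty L] [Fintype A] (M : NCTMG L A) (t ε : ℝ) (hε : 0 < ε)
    (x : L → ℝ) (hx : ∀ l, x l ∈ Set.Icc (0 : ℝ) 1)
    (f : L → ℝ → ℝ) (hf : M.SolvesBellman t ε x f) :
    ∀ l, ∀ τ ∈ Set.Icc (t - ε) t, f l τ ∈ Set.Icc (0 : ℝ) 1 := by
  obtain ⟨hterm, hderiv⟩ := hf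
  intro l τ hτ
  constructor
  · have h := le_of_hasDerivAt_nonneg_of_forall_le (c := 0) (f := fun l s => -f l s)
      (fun l => by simpa [hterm l] using (hx l).1)
      (fun l s hs => (hderiv l s hs).fun_neg)
      (fun l s _ hl => by
        rw [neg_neg]
        exact M.opt_sum_Q_nonneg (v := fun l' => f l' s) fun l' => neg_le_neg_iff.1 (hl l'))
      l τ hτ
    exact neg_nonpos.1 h
  · exact le_of_hasDerivAt_nonneg_of_forall_le
      (fun l => by simpa [hterm l] using (hx l).2) hderiv
      (fun l s _ hl => neg_nonneg.2 (M.opt_sum_Q_nonpos (v := fun l' => f l' s) hl))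
      l τ hτ
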